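/- Let f and g be harmonic on the closed unit ball in ℝ³. If f = g on some sphere of positive radius wholly contained in the open unit ball, then f = g on the whole closed unit ball (harmonic extension from an interior sphere is unique). -/

import Mathlib

open MeasureTheory Metric Real

noncomputable section

abbrev E3 := EuclideanSpace ℝ (Fin 3)

/-- The Laplacian of `f` at `x`: the sum of the three second partial derivatives. -/
def vlaplacian (f : E3 → ℝ) (x : E3) : ℝ :=
  ∑ i : Fin 3, fderiv ℝ (fun y => fderiv ℝ f y (EuclideanSpace.single i 1)) x
    (EuclideanSpace.single i 1)

/-- The II inner product: `(f,g)_II = (1/4π) ∬_σ ∂/∂r (r f g) dσ`, the surface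
integral over the unit sphere (two-dimensional Hausdorff measure) of the radial
derivative of `r ↦ r·f·g` evaluated at `r = 1`. -/
def IIinner (f g : E3 → ℝ) : ℝ :=
  (4 * π)⁻¹ * ∫ x in sphere (0 : E3) 1,
    deriv (fun t : ℝ => t * f (t • x) * g (t • x)) 1 ∂μH[2]

open Filter Topology

/-- directional derivative -/
def DD (v : E3) (u : E3 → ℝ) : E3 → ℝ := fun x => fderiv ℝ u x v

/-- coordinate vector -/
def ee (i : Fin 3) : E3 := EuclideanSpace.single i 1

/-- smooth and harmonic on `U` -/
def Harm (U : Set E3) (u : E3 → ℝ) : Prop :=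
  ContDiffOn ℝ (⊤ : ℕ∞) u U ∧ ∀ x ∈ U, vlaplacian u x = 0

theorem vlap_eq (u : E3 → ℝ) (x : E3) : vlaplacian u x = ∑ i, DD (ee i) (DD (ee i) u) x := rfl

theorem DD_smooth {U : Set E3} (hU : IsOpen U) {u : E3 → ℝ} (hu : ContDiffOn ℝ (⊤ : ℕ∞) u U)
    (v : E3) : ContDiffOn ℝ (⊤ : ℕ∞) (DD v u) U := by
  have h := hu.fderiv_of_isOpen (m := (⊤ : ℕ∞)) hU (by simp)
  exact h.clm_apply contDiffOn_const

theorem sm_diff {U : Set E3} (hU : IsOpen U) {u : E3 → ℝ} (hu : ContDiffOn ℝ (⊤ : ℕ∞) u U)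
    {x : E3} (hx : x ∈ U) : DifferentiableAt ℝ u x :=
  (hu.contDiffAt (hU.mem_nhds hx)).differentiableAt (by simp)

theorem DD_congr {U : Set E3} (hU : IsOpen U) {u w : E3 → ℝ} (h : ∀ x ∈ U, u x = w x) (v : E3) :
    ∀ x ∈ U, DD v u x = DD v w x := by
  intro x hx
  have : u =ᶠ[𝓝 x] w := by
    filter_upwards [hU.mem_nhds hx] with y hy using h y hy
  simp only [DD, this.fderiv_eq]

theorem DD_comm {U : Set E3} (hU : IsOpen U) {u : E3 → ℝ} (hu : ContDiffOn ℝ (⊤ : ℕ∞) u U)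
    (a b : E3) : ∀ x ∈ U, DD a (DD b u) x = DD b (DD a u) x := by
  intro x hx
  have hc := hu.contDiffAt (hU.mem_nhds hx)
  have hs := hc.isSymmSndFDerivAt (by
    rw [minSmoothness_of_isRCLikeNormedField]
    exact WithTop.coe_le_coe.2 (le_top : (2 : ℕ∞) ≤ ⊤))
  have hd : DifferentiableAt ℝ (fderiv ℝ u) x :=
    ((hu.fderiv_of_isOpen (m := (⊤ : ℕ∞)) hU (by simp)).contDiffAt (hU.mem_nhds hx)).differentiableAt
      (by simp)
  have key : ∀ p q : E3, DD p (DD q u) x = fderiv ℝ (fderiv ℝ u) x p q := by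
    intro p q
    unfold DD
    rw [fderiv_clm_apply hd (differentiableAt_const _)]
    simp
  rw [key, key]
  exact hs a b

theorem DD_sub {U : Set E3} (hU : IsOpen U) {u w : E3 → ℝ} (hu : ContDiffOn ℝ (⊤ : ℕ∞) u U)
    (hw : ContDiffOn ℝ (⊤ : ℕ∞) w U) (v : E3) :
    ∀ x ∈ U, DD v (fun y => u y - w y) x = DD v u x - DD v w x := by
  intro x hx
  unfold DD
  rw [fderiv_fun_sub (sm_diff hU hu hx) (sm_diff hU hw hx)]
  rfl

theorem Harm.sub {U : Set E3} (hU : IsOpen U) {u w : E3 → ℝ} (hu : Harm U u) (hw : Harm U w) :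
    Harm U (fun y => u y - w y) := by
  refine ⟨hu.1.sub hw.1, fun x hx => ?_⟩
  have h1 := hu.2 x hx
  have h2 := hw.2 x hx
  rw [vlap_eq] at *
  rw [← sub_eq_zero.2 (h1.trans h2.symm), ← Finset.sum_sub_distrib]
  refine Finset.sum_congr rfl fun i _ => ?_
  rw [DD_congr hU (DD_sub hU hu.1 hw.1 (ee i)) (ee i) x hx]
  exact DD_sub hU (DD_smooth hU hu.1 _) (DD_smooth hU hw.1 _) _ x hx

theorem DD_neg (u : E3 → ℝ) (v : E3) : DD v (fun y => - u y) = fun y => - DD v u y := by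
  funext x
  simp [DD]

theorem Harm.neg {U : Set E3} {u : E3 → ℝ} (hu : Harm U u) : Harm U (fun y => - u y) := by
  refine ⟨hu.1.neg, fun x hx => ?_⟩
  have h1 := hu.2 x hx
  rw [vlap_eq] at *
  simp [DD_neg, h1]

theorem Harm.DD {U : Set E3} (hU : IsOpen U) {u : E3 → ℝ} (hu : Harm U u) (v : E3) :
    Harm U (DD v u) := by
  refine ⟨DD_smooth hU hu.1 v, fun x hx => ?_⟩
  rw [vlap_eq]
  have h1 : ∀ i, _root_.DD (ee i) (_root_.DD (ee i) (_root_.DD v u)) x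
      = _root_.DD v (_root_.DD (ee i) (_root_.DD (ee i) u)) x := by
    intro i
    rw [DD_congr hU (DD_comm hU hu.1 (ee i) v) (ee i) x hx]
    exact DD_comm hU (DD_smooth hU hu.1 _) _ _ x hx
  simp only [h1]
  have h2 : _root_.DD v (vlaplacian u) x = _root_.DD v (fun _ => 0) x :=
    DD_congr hU hu.2 v x hx
  have h3 : _root_.DD v (vlaplacian u) x
      = ∑ i, _root_.DD v (_root_.DD (ee i) (_root_.DD (ee i) u)) x := by
    have : vlaplacian u = fun y => ∑ i, _root_.DD (ee i) (_root_.DD (ee i) u) y := rfl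
    rw [this, _root_.DD, fderiv_fun_sum]
    · simp [_root_.DD]
    · intro i _
      exact sm_diff hU (DD_smooth hU (DD_smooth hU hu.1 _) _) hx
  rw [← h3, h2]
  simp [_root_.DD]

/-- second derivative at 0 -/
def SD (φ : ℝ → ℝ) (l : ℝ) : Prop :=
  ∃ φ' : ℝ → ℝ, (∀ᶠ s in 𝓝 (0 : ℝ), HasDerivAt φ (φ' s) s) ∧ HasDerivAt φ' l 0

theorem SD.add {φ ψ : ℝ → ℝ} {l m : ℝ} (h : SD φ l) (k : SD ψ m) :
    SD (fun s => φ s + ψ s) (l + m) := by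
  obtain ⟨a, ha, ha'⟩ := h
  obtain ⟨b, hb, hb'⟩ := k
  refine ⟨fun s => a s + b s, ?_, ha'.add hb'⟩
  filter_upwards [ha, hb] with s h1 h2 using h1.add h2

theorem SD.cmul {φ : ℝ → ℝ} {l : ℝ} (c : ℝ) (h : SD φ l) : SD (fun s => c * φ s) (c * l) := by
  obtain ⟨a, ha, ha'⟩ := h
  refine ⟨fun s => c * a s, ?_, ha'.const_mul c⟩
  filter_upwards [ha] with s h1 using h1.const_mul c

theorem SD.negarg {φ : ℝ → ℝ} {l : ℝ} (h : SD φ l) : SD (fun s => φ (-s)) l := by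
  obtain ⟨a, ha, ha'⟩ := h
  refine ⟨fun s => - a (-s), ?_, ?_⟩
  · have : Tendsto (fun s : ℝ => -s) (𝓝 0) (𝓝 0) := by
      simpa using (continuous_neg (G := ℝ)).tendsto 0
    filter_upwards [this.eventually ha] with s h1
    exact (h1.comp s (hasDerivAt_neg s)).congr_deriv (by ring)
  · have h0 : HasDerivAt a l (-0 : ℝ) := by simpa using ha'
    exact (h0.comp (0 : ℝ) (hasDerivAt_neg 0)).neg.congr_deriv (by ring)

theorem SD.quad (A B C : ℝ) : SD (fun s => A + B * s + C * s ^ 2) (2 * C) := by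
  refine ⟨fun s => B + 2 * C * s, Eventually.of_forall fun s => ?_, ?_⟩
  · have := (((hasDerivAt_id s).const_mul B).const_add A).add (((hasDerivAt_id s).pow 2).const_mul C)
    exact this.congr_deriv (by simp; ring)
  · have := ((hasDerivAt_id (0 : ℝ)).const_mul (2 * C)).const_add B
    simpa using this

theorem SD.not_max {φ : ℝ → ℝ} {l : ℝ} (h : SD φ l) (hl : 0 < l) : ¬ IsLocalMax φ 0 := by
  intro hm
  obtain ⟨a, ha, ha'⟩ := h
  have hd : deriv φ =ᶠ[𝓝 0] a := by
    filter_upwards [ha] with s hs using hs.deriv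
  have hdd : deriv (deriv φ) 0 = l := by rw [hd.deriv_eq, ha'.deriv]
  have hmin := isLocalMin_of_deriv_deriv_pos (by rw [hdd]; exact hl) hm.deriv_eq_zero
    ha.self_of_nhds.continuousAt
  have hc : φ =ᶠ[𝓝 0] fun _ => φ 0 := by
    filter_upwards [hm, hmin] with s h1 h2 using le_antisymm h1 h2
  have : deriv φ =ᶠ[𝓝 0] fun _ => 0 := by
    have := hc.deriv
    simpa using this
  have h2 := this.deriv_eq
  rw [hdd] at h2
  simp at h2
  linarith

/-- Laplacian through second derivatives along coordinate lines -/
def Lap2 (w : E3 → ℝ) (x : E3) (l : ℝ) : Prop :=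
  ∃ L : Fin 3 → ℝ, (∀ i, SD (fun s => w (x + s • ee i)) (L i)) ∧ ∑ i, L i = l

theorem Lap2.add {w z : E3 → ℝ} {x : E3} {l m : ℝ} (h : Lap2 w x l) (k : Lap2 z x m) :
    Lap2 (fun y => w y + z y) x (l + m) := by
  obtain ⟨a, ha, rfl⟩ := h
  obtain ⟨b, hb, rfl⟩ := k
  exact ⟨fun i => a i + b i, fun i => (ha i).add (hb i), Finset.sum_add_distrib⟩

theorem Lap2.cmul {w : E3 → ℝ} {x : E3} {l : ℝ} (c : ℝ) (h : Lap2 w x l) :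
    Lap2 (fun y => c * w y) x (c * l) := by
  obtain ⟨a, ha, rfl⟩ := h
  exact ⟨fun i => c * a i, fun i => (ha i).cmul c, by rw [Finset.mul_sum]⟩

theorem line_deriv {u : E3 → ℝ} {x v : E3} {s : ℝ} (h : DifferentiableAt ℝ u (x + s • v)) :
    HasDerivAt (fun s : ℝ => u (x + s • v)) (DD v u (x + s • v)) s := by
  have h1 : HasDerivAt (fun s : ℝ => x + s • v) v s := by
    simpa using ((hasDerivAt_id s).smul_const v).const_add x
  exact h.hasFDerivAt.comp_hasDerivAt s h1

theorem Harm.sd {U : Set E3} (hU : IsOpen U) {u : E3 → ℝ} (hu : Harm U u) {x : E3} (hx : x ∈ U)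
    (v : E3) : SD (fun s => u (x + s • v)) (_root_.DD v (_root_.DD v u) x) := by
  refine ⟨fun s => _root_.DD v u (x + s • v), ?_, ?_⟩
  · have hc : ContinuousAt (fun s : ℝ => x + s • v) 0 := by fun_prop
    have : ∀ᶠ s in 𝓝 (0 : ℝ), x + s • v ∈ U := hc.eventually_mem (hU.mem_nhds (by simpa using hx))
    filter_upwards [this] with s hs
    exact line_deriv (sm_diff hU hu.1 hs)
  · have hx' : x + (0 : ℝ) • v ∈ U := by simpa using hx
    have := line_deriv (sm_diff hU (DD_smooth hU hu.1 v) hx')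
    simpa using this

theorem Harm.lap2 {U : Set E3} (hU : IsOpen U) {u : E3 → ℝ} (hu : Harm U u) {x : E3} (hx : x ∈ U) :
    Lap2 u x 0 :=
  ⟨fun i => _root_.DD (ee i) (_root_.DD (ee i) u) x, fun i => hu.sd hU hx (ee i), hu.2 x hx⟩

theorem normsq (z : E3) : ‖z‖ ^ 2 = z 0 ^ 2 + z 1 ^ 2 + z 2 ^ 2 := by
  rw [EuclideanSpace.norm_sq_eq, Fin.sum_univ_three]
  simp

theorem lap2_normsq (x y : E3) : Lap2 (fun z => ‖z - y‖ ^ 2) x 6 := by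
  refine ⟨fun _ => 2 * 1, fun i => ?_, by simp; norm_num⟩
  convert SD.quad (‖x - y‖ ^ 2) (2 * (x i - y i)) 1 using 1
  funext s
  simp only [normsq]
  fin_cases i <;> simp [ee] <;> ring

theorem lap2_t (x y : E3) (j : Fin 3) : Lap2 (fun z => z j - y j) x 0 := by
  refine ⟨fun _ => 2 * 0, fun i => ?_, by simp⟩
  convert SD.quad (x j - y j) (ee i j) 0 using 1
  funext s
  simp; ring

theorem lap2_tsq (x y : E3) (j : Fin 3) : Lap2 (fun z => (z j - y j) ^ 2) x 2 := by
  refine ⟨fun i => 2 * (ee i j) ^ 2, fun i => ?_, ?_⟩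
  · convert SD.quad ((x j - y j) ^ 2) (2 * (x j - y j) * ee i j) ((ee i j) ^ 2) using 1
    funext s
    simp; ring
  · fin_cases j <;> simp [ee, Fin.sum_univ_three]

theorem maxp {K V : Set E3} (hK : IsCompact K) (hV : IsOpen V) (hVK : V ⊆ K) {w : E3 → ℝ}
    (hw : ContinuousOn w K) (hl : ∀ x ∈ V, Lap2 w x 0) (hb : ∀ x ∈ K, x ∉ V → w x ≤ 0) :
    ∀ x ∈ K, w x ≤ 0 := by
  intro x hx
  by_contra! hpos
  obtain ⟨B, hB⟩ := hK.isBounded.exists_norm_le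
  have hB0 : 0 ≤ B := (norm_nonneg x).trans (hB x hx)
  set ε : ℝ := w x / (2 * (B ^ 2 + 1)) with hε
  have hεp : 0 < ε := by positivity
  have hεB : ε * B ^ 2 < w x := by
    rw [hε, div_mul_eq_mul_div, div_lt_iff₀ (by positivity)]
    nlinarith [sq_nonneg B]
  have hcont : ContinuousOn (fun z => w z + ε * ‖z - 0‖ ^ 2) K :=
    hw.add (by fun_prop)
  obtain ⟨p, hp, hmax⟩ := hK.exists_isMaxOn ⟨x, hx⟩ hcont
  have h1 : w x + ε * ‖x - 0‖ ^ 2 ≤ w p + ε * ‖p - 0‖ ^ 2 := hmax hx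
  by_cases hpV : p ∈ V
  · obtain ⟨L, hL, hs⟩ := (hl p hpV).add ((lap2_normsq p 0).cmul ε)
    have : ∃ i, 0 < L i := by
      by_contra! hneg
      have : ∑ i, L i ≤ 0 := Finset.sum_nonpos fun i _ => hneg i
      linarith
    obtain ⟨i, hi⟩ := this
    refine (hL i).not_max hi ?_
    have hc : ContinuousAt (fun s : ℝ => p + s • ee i) 0 := by fun_prop
    have : ∀ᶠ s in 𝓝 (0 : ℝ), p + s • ee i ∈ V :=
      hc.eventually_mem (hV.mem_nhds (by simpa using hpV))
    filter_upwards [this] with s hs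
    have := hmax (hVK hs)
    simpa using this
  · have h2 := hb p hp hpV
    have h3 : ‖p‖ ^ 2 ≤ B ^ 2 := pow_le_pow_left₀ (norm_nonneg _) (hB p hp) 2
    simp only [sub_zero] at h1
    nlinarith [sq_nonneg ‖x‖]

/-- reflection -/
def RR (y : E3) (j : Fin 3) (x : E3) : E3 := x - (2 * (x j - y j)) • ee j

theorem RR_norm (y : E3) (j : Fin 3) (x : E3) : ‖RR y j x - y‖ = ‖x - y‖ := by
  have : ‖RR y j x - y‖ ^ 2 = ‖x - y‖ ^ 2 := by
    rw [normsq, normsq]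
    fin_cases j <;> simp [ee, RR] <;> ring
  exact (sq_eq_sq₀ (norm_nonneg _) (norm_nonneg _)).1 this

theorem RR_line (y : E3) (j i : Fin 3) (x : E3) (s : ℝ) :
    RR y j (x + s • ee i) = RR y j x + (if i = j then -s else s) • ee i := by
  ext k
  fin_cases j <;> fin_cases i <;> fin_cases k <;> simp [ee, RR] <;> ring

theorem Harm.lap2R {U : Set E3} (hU : IsOpen U) {u : E3 → ℝ} (hu : Harm U u) {x y : E3} {j : Fin 3}
    (hx : RR y j x ∈ U) : Lap2 (fun z => u (RR y j z)) x 0 := by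
  refine ⟨fun i => _root_.DD (ee i) (_root_.DD (ee i) u) (RR y j x), fun i => ?_, hu.2 _ hx⟩
  have h := hu.sd hU hx (ee i)
  simp only [RR_line]
  split_ifs
  · exact h.negarg
  · exact h

theorem grad_one {U : Set E3} (hU : IsOpen U) {u : E3 → ℝ} (hu : Harm U u) {y : E3} {r M : ℝ}
    (hr : 0 < r) (hB : closedBall y r ⊆ U) (hM : ∀ x ∈ closedBall y r, |u x| ≤ M) (j : Fin 3) :
    DD (ee j) u y ≤ 3 * M / r := by
  have hM0 : 0 ≤ M := (abs_nonneg _).trans (hM y (mem_closedBall_self hr.le))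
  set c : ℝ := M / r ^ 2 with hc
  have hc0 : 0 ≤ c := by positivity
  have hcr : c * r ^ 2 = M := by rw [hc]; field_simp
  have hcoord : Continuous fun x : E3 => x j := by fun_prop
  have hRc : Continuous (RR y j) := by unfold RR; fun_prop
  have hRm : ∀ x ∈ closedBall y r, RR y j x ∈ closedBall y r := by
    intro x hx
    rw [mem_closedBall, dist_eq_norm] at *
    rwa [RR_norm]
  set w : E3 → ℝ := fun x => ((1 / 2) * u x + (-1 / 2) * u (RR y j x)) +
    ((-c) * ‖x - y‖ ^ 2 + ((-(c * 3 * r)) * (x j - y j) + (3 * c) * (x j - y j) ^ 2)) with hw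
  have key : ∀ x ∈ closedBall y r ∩ {x | y j ≤ x j}, w x ≤ 0 := by
    refine maxp (V := ball y r ∩ {x | y j < x j})
      ((isCompact_closedBall y r).inter_right (isClosed_le continuous_const hcoord))
      (isOpen_ball.inter (isOpen_lt continuous_const hcoord))
      (Set.inter_subset_inter ball_subset_closedBall fun x (hx : y j < x j) => (show y j ≤ x j from hx.le)) ?_ ?_ ?_
    · have h1 : ContinuousOn u (closedBall y r) := hu.1.continuousOn.mono hB
      have h2 : ContinuousOn (fun x => u (RR y j x)) (closedBall y r) :=
        h1.comp hRc.continuousOn hRm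
      refine ContinuousOn.mono ?_ Set.inter_subset_left
      refine ((h1.const_mul _).fun_add (h2.const_mul _)).fun_add ?_
      fun_prop
    · rintro x ⟨hx, -⟩
      have hx' := ball_subset_closedBall hx
      have := (((hu.lap2 hU (hB hx')).cmul (1 / 2)).add
        ((hu.lap2R hU (hB (hRm x hx'))).cmul (-1 / 2))).add
        (((lap2_normsq x y).cmul (-c)).add (((lap2_t x y j).cmul (-(c * 3 * r))).add
          ((lap2_tsq x y j).cmul (3 * c))))
      convert this using 1
      ring
    · rintro x ⟨hx, hxj⟩ hxV
      have hxj : y j ≤ x j := hxj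
      rcases eq_or_lt_of_le hxj with h | h
      · have hR : RR y j x = x := by simp [RR, h]
        simp only [hw, hR, h]
        have := mul_nonneg hc0 (sq_nonneg ‖x - y‖)
        simp
        linarith
      · have hn : ‖x - y‖ = r := by
          rw [mem_closedBall, dist_eq_norm] at hx
          refine le_antisymm hx ?_
          by_contra! hlt
          exact hxV ⟨by rwa [mem_ball, dist_eq_norm], h⟩
        have h1 := (abs_le.1 (hM x hx)).2
        have h2 := (abs_le.1 (hM _ (hRm x hx))).1
        have h3 : x j - y j ≤ r := by
          have := PiLp.norm_apply_le (x - y) j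
          rw [hn] at this
          exact (le_abs_self _).trans this
        have h4 : 0 ≤ c * ((x j - y j) * (r - (x j - y j))) :=
          mul_nonneg hc0 (mul_nonneg (by linarith) (by linarith))
        simp only [hw, hn]
        nlinarith
  -- conclude
  have hyU : y ∈ U := hB (mem_closedBall_self hr.le)
  have hd : HasDerivAt (fun s : ℝ => u (y + s • ee j)) (DD (ee j) u y) 0 := by
    have := line_deriv (u := u) (x := y) (v := ee j) (s := 0) (sm_diff hU hu.1 (by simpa using hyU))
    simpa using this
  have hd2 : HasDerivAt (fun s : ℝ => u (y + (-s) • ee j)) (-DD (ee j) u y) 0 := by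
    have h0 : HasDerivAt (fun s : ℝ => u (y + s • ee j)) (DD (ee j) u y) (-0 : ℝ) := by
      simpa using hd
    exact (h0.comp (0 : ℝ) (hasDerivAt_neg 0)).congr_deriv (by ring)
  have hF := hd.fun_sub hd2
  have hslope := hF.tendsto_slope_zero_right
  have : DD (ee j) u y - -DD (ee j) u y ≤ 6 * M / r := by
    refine le_of_tendsto hslope ?_
    filter_upwards [Ioo_mem_nhdsGT hr] with s hs
    have he : (ee j : E3) j = 1 := by simp [ee]
    have hne : ‖ee j‖ = 1 := by simp [ee]
    have hk := key (y + s • ee j) ⟨by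
      rw [mem_closedBall, dist_eq_norm]
      simp [norm_smul, hne, abs_of_pos hs.1, hs.2.le], by simp [he, hs.1.le]⟩
    have hR : RR y j (y + s • ee j) = y + (-s) • ee j := by
      rw [RR_line]; simp [RR]
    have hn : ‖y + s • ee j - y‖ = s := by simp [norm_smul, hne, abs_of_pos hs.1]
    have ht : (y + s • ee j) j - y j = s := by simp [he]
    simp only [hw, hR, hn, ht] at hk
    simp only [zero_add, zero_smul, neg_zero, add_zero, sub_self, sub_zero, smul_eq_mul]
    rw [inv_mul_le_iff₀ hs.1]
    have h6 : s * (6 * M / r) = 6 * c * r * s := by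
      rw [← hcr]; field_simp
    rw [h6]
    have hb : 0 ≤ c * s ^ 2 := by positivity
    nlinarith
  have h7 : 6 * M / r = 2 * (3 * M / r) := by ring
  linarith

theorem grad_est {U : Set E3} (hU : IsOpen U) {u : E3 → ℝ} (hu : Harm U u) {y : E3} {r M : ℝ}
    (hr : 0 < r) (hB : closedBall y r ⊆ U) (hM : ∀ x ∈ closedBall y r, |u x| ≤ M) (v : E3) :
    |DD v u y| ≤ 9 * ‖v‖ / r * M := by
  have hM0 : 0 ≤ M := (abs_nonneg _).trans (hM y (mem_closedBall_self hr.le))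
  have h1 : ∀ j, |DD (ee j) u y| ≤ 3 * M / r := by
    intro j
    have ha := grad_one hU hu hr hB hM j
    have hb := grad_one hU hu.neg hr hB (M := M) (by simpa using hM) j
    rw [DD_neg] at hb
    exact abs_le.2 ⟨by linarith, ha⟩
  have hv : v = ∑ j, v j • ee j := by
    ext k
    fin_cases k <;> simp [ee, Fin.sum_univ_three]
  have h2 : DD v u y = ∑ j, v j * DD (ee j) u y := by
    conv_lhs => rw [hv]
    simp [DD]
  rw [h2]
  calc |∑ j, v j * DD (ee j) u y| ≤ ∑ j, |v j * DD (ee j) u y| := Finset.abs_sum_le_sum_abs _ _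
    _ ≤ ∑ j : Fin 3, ‖v‖ * (3 * M / r) := by
      refine Finset.sum_le_sum fun j _ => ?_
      rw [abs_mul]
      exact mul_le_mul (PiLp.norm_apply_le v j) (h1 j) (abs_nonneg _) (norm_nonneg _)
    _ = _ := by simp; ring

theorem harm_iter {U : Set E3} (hU : IsOpen U) {u : E3 → ℝ} (hu : Harm U u) (v : E3) (n : ℕ) :
    Harm U ((DD v)^[n] u) := by
  induction n with
  | zero => exact hu
  | succ n ih => rw [Function.iterate_succ_apply']; exact ih.DD hU v

theorem iter_est {U : Set E3} (hU : IsOpen U) {u : E3 → ℝ} (hu : Harm U u) {p : E3} {R M d : ℝ}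
    (hd : 0 < d) (hB : closedBall p R ⊆ U) (hM : ∀ x ∈ closedBall p R, |u x| ≤ M) (v : E3) (n : ℕ) :
    ∀ x ∈ closedBall p (R - n * d), |(DD v)^[n] u x| ≤ (9 * ‖v‖ / d) ^ n * M := by
  induction n with
  | zero => simpa using hM
  | succ n ih =>
    intro x hx
    rw [Function.iterate_succ_apply', pow_succ', mul_assoc]
    have hsub : closedBall x d ⊆ closedBall p (R - n * d) := by
      refine closedBall_subset_closedBall' ?_
      rw [mem_closedBall] at hx
      push_cast at hx
      linarith
    refine grad_est hU (harm_iter hU hu v n) hd (hsub.trans ((closedBall_subset_closedBall ?_).trans hB))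
      (fun z hz => ih z (hsub hz)) v
    have : 0 ≤ (n : ℝ) * d := by positivity
    linarith

theorem taylor0 (N : ℕ) : ∀ (F : ℕ → ℝ → ℝ) (B : ℝ),
    (∀ n, ∀ t ∈ Set.Icc (0 : ℝ) 1, HasDerivAt (F n) (F (n + 1) t) t) → (∀ n, F n 0 = 0) →
    (∀ t ∈ Set.Icc (0 : ℝ) 1, |F N t| ≤ B) →
    ∀ t ∈ Set.Icc (0 : ℝ) 1, |F 0 t| ≤ B * t ^ N / N.factorial := by
  induction N with
  | zero => intro F B _ _ h t ht; simpa using h t ht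
  | succ N ih =>
    intro F B hF h0 hB
    have h1 := ih (fun n => F (n + 1)) B (fun n => hF (n + 1)) (fun n => h0 (n + 1)) hB
    have := image_norm_le_of_norm_deriv_right_le_deriv_boundary (f := F 0) (f' := F 1) (a := 0)
      (b := 1) (B := fun t => B * t ^ (N + 1) / (N + 1).factorial)
      (B' := fun t => B * t ^ N / N.factorial)
      (fun t ht => (hF 0 t ht).continuousAt.continuousWithinAt)
      (fun t ht => (hF 0 t ⟨ht.1, ht.2.le⟩).hasDerivWithinAt)
      (by simp [h0]) (fun t => ?_) (fun t ht => h1 t ⟨ht.1, ht.2.le⟩)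
    · exact fun t ht => this ht
    · have := (((hasDerivAt_id t).pow (N + 1)).const_mul B).div_const ((N + 1).factorial : ℝ)
      refine this.congr_deriv ?_
      rw [Nat.factorial_succ]
      push_cast
      have : (N.factorial : ℝ) ≠ 0 := by positivity
      simp
      field_simp

theorem local_vanish {U : Set E3} (hU : IsOpen U) {u : E3 → ℝ} (hu : Harm U u) {p : E3} {R : ℝ}
    (hR : 0 < R) (hB : closedBall p R ⊆ U) (h0 : u =ᶠ[𝓝 p] fun _ => 0) :
    ∀ x ∈ closedBall p (R / 100), u x = 0 := by
  intro x hx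
  obtain ⟨M, hM⟩ := (isCompact_closedBall p R).exists_bound_of_continuousOn
    (hu.1.continuousOn.mono hB)
  have hM0 : 0 ≤ M := (norm_nonneg _).trans (hM p (mem_closedBall_self hR.le))
  set v : E3 := x - p with hv
  have hvn : ‖v‖ ≤ R / 100 := by rwa [mem_closedBall, dist_eq_norm] at hx
  have hz : ∀ n, (DD v)^[n] u =ᶠ[𝓝 p] fun _ => 0 := by
    intro n
    induction n with
    | zero => exact h0
    | succ n ih =>
      rw [Function.iterate_succ_apply']
      have := ih.fderiv (𝕜 := ℝ)
      filter_upwards [this] with z hz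
      simp [DD, hz]
  have hmem : ∀ t ∈ Set.Icc (0 : ℝ) 1, p + t • v ∈ closedBall p (R / 100) := by
    intro t ht
    rw [mem_closedBall, dist_eq_norm]
    simp only [add_sub_cancel_left, norm_smul, Real.norm_eq_abs, abs_of_nonneg ht.1]
    nlinarith [norm_nonneg v, ht.1, ht.2]
  have bound : ∀ N : ℕ, 0 < N → |u x| ≤ (1 / 2) ^ N * M := by
    intro N hN
    have hN' : (0 : ℝ) < N := by exact_mod_cast hN
    have hd : 0 < R / (2 * N) := by positivity
    have hit := iter_est hU hu hd hB (by simpa using hM) v N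
    have hRN : R - N * (R / (2 * N)) = R / 2 := by field_simp; ring
    rw [hRN] at hit
    have ht := taylor0 N (fun n t => (DD v)^[n] u (p + t • v)) ((9 * ‖v‖ / (R / (2 * N))) ^ N * M)
      (fun n t ht => by
        rw [Function.iterate_succ_apply']
        exact line_deriv (sm_diff hU (harm_iter hU hu v n).1
          (hB (closedBall_subset_closedBall (by linarith) (hmem t ht)))))
      (fun n => by simpa using (hz n).self_of_nhds)
      (fun t ht => hit _ (closedBall_subset_closedBall (by linarith) (hmem t ht)))
      1 (by simp)
    have hx1 : p + (1 : ℝ) • v = x := by simp [hv]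
    simp only [Function.iterate_zero, id, hx1, one_pow, mul_one] at ht
    refine ht.trans ?_
    have he := Real.pow_div_factorial_le_exp N hN'.le N
    have he2 : Real.exp (N : ℝ) ≤ (2.72 : ℝ) ^ N := by
      rw [← Real.exp_one_pow]
      exact pow_le_pow_left₀ (Real.exp_pos _).le (by linarith [Real.exp_one_lt_d9]) _
    have h1 : 9 * ‖v‖ / (R / (2 * N)) ≤ 0.18 * N := by
      rw [div_le_iff₀ hd]
      have : 0.18 * (N : ℝ) * (R / (2 * N)) = 0.09 * R := by field_simp; norm_num
      rw [this]; linarith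
    have h2 : (9 * ‖v‖ / (R / (2 * N))) ^ N ≤ 0.18 ^ N * (N : ℝ) ^ N := by
      rw [← mul_pow]
      exact pow_le_pow_left₀ (by positivity) h1 N
    calc (9 * ‖v‖ / (R / (2 * N))) ^ N * M / N.factorial
        ≤ 0.18 ^ N * (N : ℝ) ^ N * M / N.factorial := by gcongr
      _ = 0.18 ^ N * ((N : ℝ) ^ N / N.factorial) * M := by ring
      _ ≤ 0.18 ^ N * 2.72 ^ N * M := by
        have := he.trans he2
        gcongr
      _ = (0.18 * 2.72) ^ N * M := by rw [mul_pow]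
      _ ≤ (1 / 2) ^ N * M := by gcongr; norm_num
  have hlim : Tendsto (fun N : ℕ => (1 / 2 : ℝ) ^ N * M) atTop (𝓝 0) := by
    simpa using (tendsto_pow_atTop_nhds_zero_of_lt_one (by norm_num) (by norm_num :
      (1 / 2 : ℝ) < 1)).mul_const M
  have : |u x| ≤ 0 := by
    refine ge_of_tendsto hlim ?_
    filter_upwards [eventually_gt_atTop 0] with N hN using bound N hN
  exact abs_nonpos_iff.1 this

theorem dirichlet {U : Set E3} (hU : IsOpen U) {u : E3 → ℝ} (hu : Harm U u) {c : E3} {a : ℝ}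
    (hB : closedBall c a ⊆ U) (h0 : ∀ x ∈ sphere c a, u x = 0) :
    ∀ x ∈ closedBall c a, u x ≤ 0 := by
  refine maxp (V := ball c a) (isCompact_closedBall c a) isOpen_ball ball_subset_closedBall
    (hu.1.continuousOn.mono hB) (fun x hx => hu.lap2 hU (hB (ball_subset_closedBall hx))) ?_
  intro x hx hx'
  refine (h0 x ?_).le
  rw [mem_sphere]
  rw [mem_closedBall] at hx
  rw [mem_ball] at hx'
  linarith

theorem stmt_17 (f g : E3 → ℝ) (U : Set E3) (hUopen : IsOpen U)
    (hUball : closedBall (0 : E3) 1 ⊆ U)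
    (hf : ContDiffOn ℝ (⊤ : ℕ∞) f U) (hg : ContDiffOn ℝ (⊤ : ℕ∞) g U)
    (hharmf : ∀ x ∈ U, vlaplacian f x = 0) (hharmg : ∀ x ∈ U, vlaplacian g x = 0)
    (c : E3) (a : ℝ) (ha : 0 < a)
    (hsub : closedBall c a ⊆ ball (0 : E3) 1)
    (heq : ∀ x ∈ sphere c a, f x = g x) :
    ∀ x ∈ closedBall (0 : E3) 1, f x = g x := by
  have hh : Harm U (fun y => f y - g y) := Harm.sub hUopen ⟨hf, hharmf⟩ ⟨hg, hharmg⟩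
  set h : E3 → ℝ := fun y => f y - g y with hdef
  have hcU : closedBall c a ⊆ U := hsub.trans (ball_subset_closedBall.trans hUball)
  have hs : ∀ x ∈ sphere c a, h x = 0 := fun x hx => sub_eq_zero.2 (heq x hx)
  have hz : ∀ x ∈ closedBall c a, h x = 0 := by
    intro x hx
    have h1 := dirichlet hUopen hh hcU hs x hx
    have h2 := dirichlet hUopen hh.neg hcU (fun x hx => by simp [hs x hx]) x hx
    linarith
  have hmain : closedBall (0 : E3) 1 ⊆ {p | h =ᶠ[𝓝 p] fun _ => 0} := by
    refine (convex_closedBall (0 : E3) 1).isPreconnected.subset_of_closure_inter_subset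
      isOpen_setOfPred_eventually_nhds ?_ ?_
    · refine ⟨c, ball_subset_closedBall (hsub (mem_closedBall_self ha.le)), ?_⟩
      exact Filter.mem_of_superset (closedBall_mem_nhds c ha) hz
    · rintro p ⟨hp, hp1⟩
      obtain ⟨R, hR, hRU⟩ := Metric.nhds_basis_closedBall.mem_iff.1 (hUopen.mem_nhds (hUball hp1))
      obtain ⟨q, hq, hpq⟩ := Metric.mem_closure_iff.1 hp (R / 400) (by positivity)
      have hv := local_vanish hUopen hh (p := q) (R := R / 2) (by positivity)
        ((closedBall_subset_closedBall' (by rw [dist_comm]; linarith)).trans hRU) hq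
      refine Filter.mem_of_superset (closedBall_mem_nhds p (by positivity : 0 < R / 400)) ?_
      intro z hz
      exact hv z (closedBall_subset_closedBall' (by linarith) hz)
  intro x hx
  have hx0 : h =ᶠ[𝓝 x] fun _ => 0 := hmain hx
  exact sub_eq_zero.1 hx0.self_of_nhds

end
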